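/- Let α ∈ ℝ⁶ satisfy α₁ ≥ α₂ ≥ α₃ ≥ α₄ ≥ α₅ ≥ α₆ ≥ α₁ − 1 and α₁ + ⋯ + α₆ = 1. If α₁ + α₂ ≥ 1 and α₄ + α₅ ≥ 0, then ζ₀ := α₃ + α₄ + α₅ lies in [0, 1/2] and for every ζ ∈ [0, 1/2] one has fob(α, ζ) ≤ fob(α, ζ₀); that is, on [0, 1/2] the function fob(α, ·) attains its maximum at ζ = α₃ + α₄ + α₅. -/

import Mathlib

/-- `g(x) = x(x-1)(2x-1)/6`. -/
noncomputable def g (x : ℝ) : ℝ := x * (x - 1) * (2 * x - 1) / 6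

/-- The first order behavior
`fob(α, ζ) = Σ_{1≤r<s≤6} g({α_r + α_s}) − Σ_{r=1}^{6} ( g({α_r − ζ}) + g({α_r + ζ}) )`. -/
noncomputable def fob (α : Fin 6 → ℝ) (ζ : ℝ) : ℝ :=
  (∑ r : Fin 6, ∑ s : Fin 6, if r < s then g (Int.fract (α r + α s)) else 0)
  - ∑ r : Fin 6, (g (Int.fract (α r - ζ)) + g (Int.fract (α r + ζ)))

/-- On `[-1, 2)` the periodization of `g` differs from `g` by squares of truncations. -/
lemma g_fract_eq {x : ℝ} (h₁ : -1 ≤ x) (h₂ : x < 2) :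
    g (Int.fract x) = g x + max (-x) 0 ^ 2 - max (x - 1) 0 ^ 2 := by
  rcases lt_or_ge x 0 with h | h
  · have hf : Int.fract x = x + 1 :=
      Int.fract_eq_iff.2 ⟨by linarith, by linarith, -1, by push_cast; ring⟩
    rw [hf, max_eq_left (by linarith), max_eq_right (by linarith)]
    unfold g; ring
  rcases lt_or_ge x 1 with h' | h'
  · rw [Int.fract_eq_self.2 ⟨h, h'⟩, max_eq_right (by linarith), max_eq_right (by linarith)]
    ring
  · have hf : Int.fract x = x - 1 :=
      Int.fract_eq_iff.2 ⟨by linarith, by linarith, 1, by push_cast; ring⟩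
    rw [hf, max_eq_right (by linarith), max_eq_left (by linarith)]
    unfold g; ring

lemma g_fract_sub_add_g_fract_add {x ζ : ℝ} (h₁ : -(1 / 2) ≤ x) (h₂ : x ≤ 1)
    (hζ : ζ ∈ Set.Icc (0 : ℝ) (1 / 2)) :
    g (Int.fract (x - ζ)) + g (Int.fract (x + ζ)) =
      2 * g x + (2 * x - 1) * ζ ^ 2 + max (ζ - x) 0 ^ 2 + max (-x - ζ) 0 ^ 2
        - max (x + ζ - 1) 0 ^ 2 := by
  obtain ⟨h0, h3⟩ := hζ
  rw [g_fract_eq (by linarith) (by linarith), g_fract_eq (by linarith) (by linarith),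
    max_eq_right (show x - ζ - 1 ≤ 0 by linarith), neg_sub, neg_add']
  unfold g; ring

/-- On `[0, ∞)` the right-hand side is smallest at `ζ = c + d + e`, where it equals the left-hand
side. -/
lemma truncated_squares_left {c d e ζ : ℝ} (hdc : d ≤ c) (hed : e ≤ d) (hde : 0 ≤ d + e)
    (h0 : 0 ≤ ζ) :
    (c + d + e - c) ^ 2 + (c + d + e - d) ^ 2 + (c + d + e - e) ^ 2 - 2 * (c + d + e) ^ 2 ≤
      max (ζ - c) 0 ^ 2 + max (ζ - d) 0 ^ 2 + max (ζ - e) 0 ^ 2 + max (-e - ζ) 0 ^ 2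
        - 2 * ζ ^ 2 := by
  rcases max_cases (ζ - c) 0 with ⟨h1, h1'⟩ | ⟨h1, h1'⟩ <;>
  rcases max_cases (ζ - d) 0 with ⟨h2, h2'⟩ | ⟨h2, h2'⟩ <;>
  rcases max_cases (ζ - e) 0 with ⟨h3, h3'⟩ | ⟨h3, h3'⟩ <;>
  rcases max_cases (-e - ζ) 0 with ⟨h4, h4'⟩ | ⟨h4, h4'⟩ <;>
  rw [h1, h2, h3, h4] <;>
  nlinarith [sq_nonneg (ζ - (c + d + e))]

lemma truncated_squares_right {z φ A b ζ : ℝ} (hzφ : z ≤ φ) (hφA : φ ≤ A) (hAb : A ≤ b)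
    (hAb' : A ≤ 1 - b) (hs : φ - z = b - A) (hφζ : φ ≤ ζ) (hζ : ζ ≤ 1 / 2) :
    max (ζ - A) 0 ^ 2 + max (b + ζ - 1) 0 ^ 2 + (ζ - φ) ^ 2 ≤
      (ζ - z) ^ 2 + max (ζ - b) 0 ^ 2 := by
  obtain rfl : z = φ - (b - A) := by linarith
  rcases max_cases (ζ - A) 0 with ⟨h1, h1'⟩ | ⟨h1, h1'⟩ <;>
  rcases max_cases (b + ζ - 1) 0 with ⟨h2, h2'⟩ | ⟨h2, h2'⟩ <;>
  rcases max_cases (ζ - b) 0 with ⟨h3, h3'⟩ | ⟨h3, h3'⟩ <;>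
  rw [h1, h2, h3] <;>
  nlinarith [mul_nonneg (sub_nonneg.2 hAb) (sub_nonneg.2 hφA),
    mul_nonneg (sub_nonneg.2 hAb) (sub_nonneg.2 hφζ)]

/-- Case `α₁+α₂ ≥ 1`, `α₄+α₅ ≥ 0`: on `[0, 1/2]` the function `fob(α, ·)` attains
its maximum at `ζ₀ = α₃+α₄+α₅ ∈ [0, 1/2]`. -/
theorem fob_max_at_internal_point
    (α : Fin 6 → ℝ)
    (h01 : α 1 ≤ α 0) (h12 : α 2 ≤ α 1) (h23 : α 3 ≤ α 2)
    (h34 : α 4 ≤ α 3) (h45 : α 5 ≤ α 4) (h50 : α 0 - 1 ≤ α 5)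
    (hsum : ∑ r, α r = 1)
    (hA : 1 ≤ α 0 + α 1) (hB : 0 ≤ α 3 + α 4) :
    (α 2 + α 3 + α 4) ∈ Set.Icc (0 : ℝ) (1 / 2) ∧
      ∀ ζ ∈ Set.Icc (0 : ℝ) (1 / 2),
        fob α ζ ≤ fob α (α 2 + α 3 + α 4) := by
  rw [Fin.sum_univ_six] at hsum
  have hz : α 2 + α 3 + α 4 ∈ Set.Icc (0 : ℝ) (1 / 2) := ⟨by linarith, by linarith⟩
  refine ⟨hz, fun ζ hζ => sub_le_sub_left ?_ _⟩
  have key (r : Fin 6) {ξ : ℝ} (hξ : ξ ∈ Set.Icc (0 : ℝ) (1 / 2)) :=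
    g_fract_sub_add_g_fract_add (x := α r) (by fin_cases r <;> simp <;> linarith)
      (by fin_cases r <;> simp <;> linarith) hξ
  have key (ξ : ℝ) (hξ : ξ ∈ Set.Icc (0 : ℝ) (1 / 2)) :
      ∑ r, (g (Int.fract (α r - ξ)) + g (Int.fract (α r + ξ))) =
        2 * ∑ r, g (α r) - 4 * ξ ^ 2 + (ξ - α 5) ^ 2 + max (-α 5 - ξ) 0 ^ 2
          + (max (ξ - α 2) 0 ^ 2 + max (ξ - α 3) 0 ^ 2 + max (ξ - α 4) 0 ^ 2
            + max (-α 4 - ξ) 0 ^ 2)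
          - max (ξ - (1 - α 0)) 0 ^ 2 + max (ξ - α 1) 0 ^ 2 - max (α 1 + ξ - 1) 0 ^ 2 := by
    rw [Finset.sum_congr rfl fun r _ => g_fract_sub_add_g_fract_add
      (show -(1 / 2) ≤ α r by fin_cases r <;> simp <;> linarith)
      (show α r ≤ 1 by fin_cases r <;> simp <;> linarith) hξ]
    obtain ⟨hξ0, hξ1⟩ := hξ
    simp only [Fin.sum_univ_six]
    rw [max_eq_right (show ξ - α 0 ≤ 0 by linarith),
      max_eq_right (show -α 0 - ξ ≤ 0 by linarith),
      max_eq_right (show -α 1 - ξ ≤ 0 by linarith),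
      max_eq_right (show -α 2 - ξ ≤ 0 by linarith),
      max_eq_right (show α 2 + ξ - 1 ≤ 0 by linarith),
      max_eq_right (show -α 3 - ξ ≤ 0 by linarith),
      max_eq_right (show α 3 + ξ - 1 ≤ 0 by linarith),
      max_eq_right (show α 4 + ξ - 1 ≤ 0 by linarith),
      max_eq_right (show α 5 + ξ - 1 ≤ 0 by linarith),
      max_eq_left (show 0 ≤ ξ - α 5 by linarith),
      show α 0 + ξ - 1 = ξ - (1 - α 0) by ring]
    linear_combination 2 * ξ ^ 2 * hsum
  rw [key _ hz, key _ hζ]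
  obtain ⟨hζ0, hζ1⟩ := hζ
  have hmid := truncated_squares_left h23 h34 hB hζ0
  set z := α 2 + α 3 + α 4 with hzdef
  rw [max_eq_left (show 0 ≤ -α 5 - z by linarith),
    max_eq_left (show 0 ≤ z - α 2 by linarith), max_eq_left (show 0 ≤ z - α 3 by linarith),
    max_eq_left (show 0 ≤ z - α 4 by linarith), max_eq_right (show -α 4 - z ≤ 0 by linarith),
    max_eq_right (show z - (1 - α 0) ≤ 0 by linarith),
    max_eq_right (show z - α 1 ≤ 0 by linarith),
    max_eq_right (show α 1 + z - 1 ≤ 0 by linarith)]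
  rcases le_total ζ (-α 5) with h | h
  · rw [max_eq_left (show 0 ≤ -α 5 - ζ by linarith),
      max_eq_right (show ζ - (1 - α 0) ≤ 0 by linarith),
      max_eq_right (show ζ - α 1 ≤ 0 by linarith),
      max_eq_right (show α 1 + ζ - 1 ≤ 0 by linarith)]
    linarith
  · have hright := truncated_squares_right (z := z) (φ := -α 5) (A := 1 - α 0) (b := α 1)
      (by linarith) (by linarith) (by linarith) (by linarith) (by linarith) h hζ1
    rw [max_eq_right (show -α 5 - ζ ≤ 0 by linarith),
      max_eq_left (show 0 ≤ ζ - α 2 by linarith), max_eq_left (show 0 ≤ ζ - α 3 by linarith),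
      max_eq_left (show 0 ≤ ζ - α 4 by linarith), max_eq_right (show -α 4 - ζ ≤ 0 by linarith)]
    have hid : (ζ - α 2) ^ 2 + (ζ - α 3) ^ 2 + (ζ - α 4) ^ 2 - 2 * ζ ^ 2 =
        (ζ - z) ^ 2 + ((z - α 2) ^ 2 + (z - α 3) ^ 2 + (z - α 4) ^ 2 - 2 * z ^ 2) := by
      rw [hzdef]; ring
    linarith
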